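/- Let n ≥ 2 and 1 < p, p̃ < ∞, −1/p < λ < 1/n. Then the spherical Hardy operator 𝓗 satisfies ‖𝓗f‖_{CMOL^{p,λ}_{rad}L^{p̃}_{ang}(ℝⁿ)} ≤ (1/(1+λ)) ‖f‖_{CMOL^{p,λ}_{rad}L^{p̃}_{ang}(ℝⁿ)}, and 1/(1+λ) is the exact operator norm of 𝓗 on this mixed radial-angular λ-central BMO space. -/

import Mathlib

open MeasureTheory Set ENNReal Metric

/-- The surface measure on the unit sphere `S^{n-1}` in `ℝⁿ`. -/
noncomputable def sphereMeasure (n : ℕ) :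
    Measure (sphere (0 : EuclideanSpace ℝ (Fin n)) 1) :=
  (volume : Measure (EuclideanSpace ℝ (Fin n))).toSphere

/-- The volume `ν_n` of the unit ball in `ℝⁿ`. -/
noncomputable def nu (n : ℕ) : ℝ :=
  (volume (ball (0 : EuclideanSpace ℝ (Fin n)) 1)).toReal

/-- The average of `f` over the ball `B(0,r)`. -/
noncomputable def ballAvg (n : ℕ) (f : EuclideanSpace ℝ (Fin n) → ℝ) (r : ℝ) : ℝ :=
  (∫ y in ball (0 : EuclideanSpace ℝ (Fin n)) r, f y) /
    (volume (ball (0 : EuclideanSpace ℝ (Fin n)) r)).toReal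

/-- The mixed radial-angular `λ`-central bounded mean oscillation norm
`sup_{r>0} (ν_n^{-1} r^{-n-nλp} ∫₀^r (∫_{S^{n-1}} |f(ρθ)-f_{B(0,r)}|^{pt} dσ)^{p/pt}
ρ^{n-1} dρ)^{1/p}`. -/
noncomputable def cmoMixedNorm (n : ℕ) (p pt lam : ℝ)
    (f : EuclideanSpace ℝ (Fin n) → ℝ) : ℝ≥0∞ :=
  ⨆ (r : ℝ) (_ : 0 < r),
    ((ENNReal.ofReal (nu n * r ^ ((n : ℝ) + n * lam * p)))⁻¹ *
      ∫⁻ ρ in Ioc (0 : ℝ) r,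
        (∫⁻ θ : sphere (0 : EuclideanSpace ℝ (Fin n)) 1,
            ENNReal.ofReal |f (ρ • (θ : EuclideanSpace ℝ (Fin n))) - ballAvg n f r| ^ pt
          ∂(sphereMeasure n)) ^ (p / pt) *
          ENNReal.ofReal (ρ ^ ((n : ℝ) - 1))) ^ (1 / p)

/-- The spherical Hardy operator `𝓗f(x) = (1/(ν_n|x|ⁿ)) ∫_{|y|≤|x|} f(y) dy`. -/
noncomputable def sphericalHardy (n : ℕ) (f : EuclideanSpace ℝ (Fin n) → ℝ)
    (x : EuclideanSpace ℝ (Fin n)) : ℝ :=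
  (volume (ball (0 : EuclideanSpace ℝ (Fin n)) ‖x‖)).toReal⁻¹ *
    ∫ y in closedBall (0 : EuclideanSpace ℝ (Fin n)) ‖x‖, f y

noncomputable def sphInt (n : ℕ) (f : EuclideanSpace ℝ (Fin n) → ℝ) (s : ℝ) : ℝ :=
  ∫ θ : sphere (0 : EuclideanSpace ℝ (Fin n)) 1, f (s • (θ : EuclideanSpace ℝ (Fin n)))
    ∂(sphereMeasure n)

instance instFiniteSphereMeasure (n : ℕ) : IsFiniteMeasure (sphereMeasure n) := by
  unfold sphereMeasure; infer_instance

lemma polar_aux (n : ℕ) (hn : 2 ≤ n) (f : EuclideanSpace ℝ (Fin n) → ℝ) (hf : Integrable f) :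
    IntegrableOn (fun s : ℝ => s ^ (n - 1) * sphInt n f s) (Ioi 0) ∧
    ∫ y, f y = ∫ s in Ioi (0 : ℝ), s ^ (n - 1) * sphInt n f s := by
  have : Nonempty (Fin n) := ⟨⟨0, by omega⟩⟩
  let E := EuclideanSpace ℝ (Fin n)
  let μ : Measure E := volume
  have hdim : Module.finrank ℝ E = n := by simp [E]
  have hmp := μ.measurePreserving_homeomorphUnitSphereProd
  rw [hdim] at hmp
  have hemb := (homeomorphUnitSphereProd E).measurableEmbedding
  let g : sphere (0 : E) 1 × Ioi (0 : ℝ) → ℝ := fun q => f ((q.2 : ℝ) • (q.1 : E))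
  have hcomp : ∀ x : ({(0 : E)}ᶜ : Set E), g (homeomorphUnitSphereProd E x) = f x := by
    intro x
    have := congrArg Subtype.val ((homeomorphUnitSphereProd E).symm_apply_apply x)
    rw [homeomorphUnitSphereProd_symm_apply_coe] at this
    simp only [g]
    rw [this]
  have hgint : Integrable g (μ.toSphere.prod (.volumeIoiPow (n - 1))) := by
    rw [← hmp.integrable_comp_emb hemb]
    have : g ∘ homeomorphUnitSphereProd E = f ∘ Subtype.val := by
      funext x; exact hcomp x
    rw [this, ← integrableOn_iff_comap_subtypeVal (measurableSet_singleton _).compl]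
    exact hf.integrableOn
  have hgeq : ∫ y, f y = ∫ q, g q ∂(μ.toSphere.prod (.volumeIoiPow (n - 1))) := by
    rw [← hmp.integral_comp hemb]
    simp_rw [hcomp]
    rw [integral_subtype_comap (measurableSet_singleton _).compl fun x ↦ f x,
        restrict_compl_singleton]
  have h2 : Integrable (fun s : Ioi (0 : ℝ) => sphInt n f s) (.volumeIoiPow (n - 1)) :=
    hgint.integral_prod_right
  have h3 : ∫ q, g q ∂(μ.toSphere.prod (.volumeIoiPow (n - 1)))
      = ∫ s : Ioi (0 : ℝ), sphInt n f s ∂(.volumeIoiPow (n - 1)) :=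
    integral_prod_symm g hgint
  constructor
  · rw [integrableOn_iff_comap_subtypeVal measurableSet_Ioi]
    rw [Measure.volumeIoiPow, integrable_withDensity_iff_integrable_smul' (by fun_prop) (by simp)] at h2
    refine h2.congr (.of_forall ?_)
    rintro ⟨x, hx : 0 < x⟩
    simp (disch := positivity) [ENNReal.toReal_ofReal]
  · rw [hgeq, h3, Measure.volumeIoiPow, integral_withDensity_eq_integral_toReal_smul (by fun_prop) (by simp),
      ← integral_subtype_comap measurableSet_Ioi (fun s : ℝ => s ^ (n - 1) * sphInt n f s)]
    refine integral_congr_ae (.of_forall ?_)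
    rintro ⟨x, hx : 0 < x⟩
    simp (disch := positivity) [ENNReal.toReal_ofReal]

lemma polar (n : ℕ) (hn : 2 ≤ n) (f : EuclideanSpace ℝ (Fin n) → ℝ) (r : ℝ)
    (hf : IntegrableOn f (ball 0 r)) :
    IntegrableOn (fun s : ℝ => s ^ (n - 1) * sphInt n f s) (Ioo 0 r) ∧
    ∫ y in ball 0 r, f y = ∫ s in Ioo (0 : ℝ) r, s ^ (n - 1) * sphInt n f s := by
  have h := polar_aux n hn ((ball 0 r).indicator f) (hf.integrable_indicator measurableSet_ball)
  have he : ∀ s ∈ Ioi (0 : ℝ), s ^ (n - 1) * sphInt n ((ball 0 r).indicator f) s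
      = (Iio r).indicator (fun s : ℝ => s ^ (n - 1) * sphInt n f s) s := by
    intro s hs
    by_cases hsr : s < r
    · rw [indicator_of_mem (by exact hsr)]
      congr 1
      unfold sphInt
      refine integral_congr_ae (.of_forall fun θ => ?_)
      simp only
      rw [indicator_of_mem]
      simp [norm_smul, abs_of_pos (show 0 < s from hs), hsr]
    · rw [indicator_of_notMem (by exact hsr)]
      unfold sphInt
      have : ∀ θ : sphere (0 : EuclideanSpace ℝ (Fin n)) 1,
        (ball 0 r).indicator f (s • (θ : EuclideanSpace ℝ (Fin n))) = 0 := by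
        intro θ
        rw [indicator_of_notMem]
        simp [norm_smul, abs_of_pos (show 0 < s from hs)]
        linarith
      simp [this]
  constructor
  · have h1 := (integrableOn_congr_fun he measurableSet_Ioi).1 h.1
    rw [integrableOn_indicator_iff measurableSet_Iio] at h1
    rw [inter_comm] at h1
    exact h1
  · rw [← integral_indicator measurableSet_ball, h.2, setIntegral_congr_fun measurableSet_Ioi he,
      setIntegral_indicator measurableSet_Iio]
    rfl

lemma nu_pos (n : ℕ) : 0 < nu n := by
  unfold nu
  exact ENNReal.toReal_pos (measure_ball_pos _ _ one_pos).ne' measure_ball_lt_top.ne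

lemma vol_ball (n : ℕ) (r : ℝ) (hr : 0 < r) :
    (volume (ball (0 : EuclideanSpace ℝ (Fin n)) r)).toReal = r ^ n * nu n := by
  rw [Measure.addHaar_ball_of_pos _ _ hr, ENNReal.toReal_mul, ENNReal.toReal_ofReal (by positivity)]
  simp [nu]

lemma sphere_univ (n : ℕ) : (sphereMeasure n).real univ = n * nu n := by
  unfold sphereMeasure nu
  rw [Measure.toSphere_real_apply_univ]
  simp [Measure.real]

/-- spherical mean -/
noncomputable def sphMean (n : ℕ) (f : EuclideanSpace ℝ (Fin n) → ℝ) (s : ℝ) : ℝ :=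
  sphInt n f s / (n * nu n)

noncomputable def Phi (n : ℕ) (f : EuclideanSpace ℝ (Fin n) → ℝ) (r : ℝ) : ℝ :=
  ∫ t in Ioo (0 : ℝ) 1, n * t ^ (n - 1) * sphMean n f (t * r)

lemma ballAvg_eq_Phi (n : ℕ) (hn : 2 ≤ n) (f : EuclideanSpace ℝ (Fin n) → ℝ) (r : ℝ) (hr : 0 < r)
    (hf : IntegrableOn f (ball 0 r)) :
    IntegrableOn (fun t : ℝ => n * t ^ (n - 1) * sphMean n f (t * r)) (Ioo 0 1) ∧
    ballAvg n f r = Phi n f r := by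
  obtain ⟨h1, h2⟩ := polar n hn f r hf
  have hν := nu_pos n
  have hn0 : (0 : ℝ) < n := by positivity
  have key : ∀ t : ℝ, n * t ^ (n - 1) * sphMean n f (t * r)
      = (r ^ (n - 1) * nu n)⁻¹ * ((t * r) ^ (n - 1) * sphInt n f (t * r)) := by
    intro t
    unfold sphMean
    rw [mul_pow]
    field_simp
  rw [← intervalIntegrable_iff_integrableOn_Ioo_of_le hr.le] at h1
  rw [← integral_Ioc_eq_integral_Ioo, ← intervalIntegral.integral_of_le hr.le] at h2
  constructor
  · rw [← intervalIntegrable_iff_integrableOn_Ioo_of_le zero_le_one]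
    simp_rw [key]
    have h3 := h1.comp_mul_right (c := r)
    simp only [zero_div, div_self hr.ne'] at h3
    exact h3.const_mul _
  · unfold ballAvg Phi
    rw [h2, vol_ball n r hr, ← integral_Ioc_eq_integral_Ioo,
      ← intervalIntegral.integral_of_le zero_le_one]
    simp_rw [key]
    rw [intervalIntegral.integral_const_mul,
      intervalIntegral.integral_comp_mul_right (fun s => s ^ (n - 1) * sphInt n f s) hr.ne']
    simp only [zero_mul, one_mul, smul_eq_mul]
    obtain ⟨m, rfl⟩ : ∃ m, n = m + 1 := ⟨n - 1, by omega⟩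
    simp only [Nat.add_sub_cancel]
    rw [pow_succ]
    field_simp

lemma hardy_eq (n : ℕ) (f : EuclideanSpace ℝ (Fin n) → ℝ)
    (x : EuclideanSpace ℝ (Fin n)) (hx : x ≠ 0) : sphericalHardy n f x = ballAvg n f ‖x‖ := by
  unfold sphericalHardy ballAvg
  have : closedBall (0 : EuclideanSpace ℝ (Fin n)) ‖x‖ =ᵐ[volume]
      ball (0 : EuclideanSpace ℝ (Fin n)) ‖x‖ := by
    refine (ae_eq_of_subset_of_measure_ge ball_subset_closedBall ?_ measurableSet_ball.nullMeasurableSet ?_).symm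
    · rw [Measure.addHaar_closedBall _ _ (norm_nonneg x),
        Measure.addHaar_ball_of_pos _ _ (norm_pos_iff.2 hx)]
    · exact measure_closedBall_lt_top.ne
  rw [setIntegral_congr_set this, div_eq_inv_mul]

lemma sphMean_radial (n : ℕ) (hn : 2 ≤ n) (f : EuclideanSpace ℝ (Fin n) → ℝ) (s c : ℝ)
    (h : ∀ θ : sphere (0 : EuclideanSpace ℝ (Fin n)) 1, f (s • (θ : EuclideanSpace ℝ (Fin n))) = c) :
    sphMean n f s = c := by
  unfold sphMean sphInt
  have hν := nu_pos n
  simp only [h]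
  rw [integral_const, sphere_univ]
  simp only [smul_eq_mul]
  have hn0 : (0 : ℝ) < n := by positivity
  field_simp

lemma lintegral_scale (G : ℝ → ℝ≥0∞) (hG : Measurable G) (t r : ℝ) (ht : 0 < t) :
    ∫⁻ ρ in Ioc (0 : ℝ) r, G (t * ρ) = ENNReal.ofReal t⁻¹ * ∫⁻ s in Ioc (0 : ℝ) (t * r), G s := by
  have h := Real.map_volume_mul_left ht.ne'
  rw [← lintegral_indicator measurableSet_Ioc, ← lintegral_indicator measurableSet_Ioc]
  have h2 : ∫⁻ s, (Ioc (0 : ℝ) (t * r)).indicator G s ∂(Measure.map (t * ·) volume)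
      = ∫⁻ ρ, (Ioc (0 : ℝ) (t * r)).indicator G (t * ρ) :=
    lintegral_map (hG.indicator measurableSet_Ioc) (by fun_prop)
  rw [h, lintegral_smul_measure, abs_of_pos (inv_pos.2 ht)] at h2
  rw [smul_eq_mul] at h2
  rw [h2]
  refine lintegral_congr fun ρ => ?_
  simp only [indicator, mem_Ioc, mul_le_mul_iff_right₀ ht, mul_pos_iff_of_pos_left ht]

lemma holder_fin {α : Type*} [MeasurableSpace α] (μ : Measure α) (p : ℝ) (hp : 1 < p)
    (g : α → ℝ≥0∞) (hg : Measurable g) :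
    (∫⁻ x, g x ∂μ) ^ p ≤ μ univ ^ (p - 1) * ∫⁻ x, g x ^ p ∂μ := by
  have hp0 : 0 < p := by linarith
  have h := ENNReal.lintegral_mul_le_Lp_mul_Lq μ (Real.HolderConjugate.conjExponent hp)
    hg.aemeasurable (g := fun _ => 1) aemeasurable_const
  simp only [Pi.mul_apply, mul_one, ENNReal.one_rpow, lintegral_const, one_mul] at h
  calc _ ≤ ((∫⁻ x, g x ^ p ∂μ) ^ (1 / p) * μ univ ^ (1 / p.conjExponent)) ^ p := by gcongr
    _ = _ := by
      rw [ENNReal.mul_rpow_of_nonneg _ _ hp0.le, ← ENNReal.rpow_mul, ← ENNReal.rpow_mul,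
        one_div_mul_cancel hp0.ne', ENNReal.rpow_one, mul_comm]
      congr 2
      unfold Real.conjExponent
      have : p - 1 ≠ 0 := by linarith
      field_simp

lemma lintegral_pow_unit (b : ℝ) (hb : -1 < b) :
    ∫⁻ t in Ioo (0 : ℝ) 1, ENNReal.ofReal (t ^ b) = ENNReal.ofReal (1 / (1 + b)) := by
  have hi : IntegrableOn (fun t : ℝ => t ^ b) (Ioo 0 1) := by
    rw [← intervalIntegrable_iff_integrableOn_Ioo_of_le zero_le_one]
    exact intervalIntegral.intervalIntegrable_rpow' hb
  rw [← ofReal_integral_eq_lintegral_ofReal hi]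
  · rw [← integral_Ioc_eq_integral_Ioo, ← intervalIntegral.integral_of_le zero_le_one,
      integral_rpow (Or.inl hb)]
    rw [Real.one_rpow, Real.zero_rpow (by linarith), sub_zero, add_comm]
  · filter_upwards [ae_restrict_mem measurableSet_Ioo] with t ht
    exact Real.rpow_nonneg ht.1.le _

lemma hardyJ (n : ℕ) (hn : 2 ≤ n) (p a : ℝ) (hp : 1 < p) (ha : -1 < a)
    (κ : Measure ℝ) [SFinite κ] (g : ℝ → ℝ → ℝ≥0∞) (hg : Measurable (Function.uncurry g))
    (A : ℝ≥0∞)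
    (h : ∀ t ∈ Ioo (0 : ℝ) 1, ∫⁻ ρ, g t ρ ^ p ∂κ ≤ A * ENNReal.ofReal (t ^ (n * a * p))) :
    ∫⁻ ρ, (∫⁻ t in Ioo (0 : ℝ) 1, ENNReal.ofReal (n * t ^ (n - 1)) * g t ρ) ^ p ∂κ
      ≤ ENNReal.ofReal (1 / (1 + a)) ^ p * A := by
  have hp0 : 0 < p := by linarith
  have hn0 : (0 : ℝ) < n := by positivity
  have h1n : 1 ≤ n := by omega
  let d : ℝ → ℝ≥0∞ := fun t => ENNReal.ofReal (n * t ^ ((n : ℝ) - 1 + n * a))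
  have hd : Measurable d := by fun_prop
  let μ : Measure ℝ := (volume.restrict (Ioo (0 : ℝ) 1)).withDensity d
  have hμ : μ univ = ENNReal.ofReal (1 / (1 + a)) := by
    simp only [μ, withDensity_apply _ MeasurableSet.univ, Measure.restrict_univ, d]
    simp_rw [ENNReal.ofReal_mul hn0.le]
    rw [lintegral_const_mul _ (by fun_prop), lintegral_pow_unit _ (by nlinarith),
      ← ENNReal.ofReal_mul hn0.le]
    congr 1
    have : 1 + a ≠ 0 := by linarith
    have : 1 + ((n : ℝ) - 1 + n * a) = n * (1 + a) := by ring
    rw [this]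
    field_simp
  have hh_int : ∀ G : ℝ → ℝ≥0∞, Measurable G → ∫⁻ t, G t ∂μ = ∫⁻ t in Ioo (0 : ℝ) 1, d t * G t := by
    intro G hG
    exact lintegral_withDensity_eq_lintegral_mul _ hd hG
  have hgt : ∀ ρ, Measurable fun t => g t ρ := fun ρ => hg.comp (measurable_id.prodMk measurable_const)
  have hgr : ∀ t, Measurable fun ρ => g t ρ := fun ρ => hg.comp (measurable_const.prodMk measurable_id)
  have e1 : ∀ ρ, ∫⁻ t in Ioo (0 : ℝ) 1, ENNReal.ofReal (n * t ^ (n - 1)) * g t ρ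
      = ∫⁻ t, ENNReal.ofReal (t ^ (-(n * a))) * g t ρ ∂μ := by
    intro ρ
    rw [hh_int _ (by have := hgt ρ; fun_prop)]
    refine setLIntegral_congr_fun measurableSet_Ioo fun t ht => ?_
    simp only [d]
    rw [← mul_assoc, ← ENNReal.ofReal_mul (by have := ht.1; positivity), mul_assoc,
      ← Real.rpow_add ht.1]
    congr 3
    rw [← Real.rpow_natCast, Nat.cast_sub h1n]
    congr 1
    push_cast
    ring
  calc _ ≤ ∫⁻ ρ, ENNReal.ofReal (1 / (1 + a)) ^ (p - 1) *
        ∫⁻ t, (ENNReal.ofReal (t ^ (-(n * a))) * g t ρ) ^ p ∂μ ∂κ := by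
        refine lintegral_mono fun ρ => ?_
        simp only
        rw [e1, ← hμ]
        exact holder_fin μ p hp _ (by have := hgt ρ; fun_prop)
    _ = ENNReal.ofReal (1 / (1 + a)) ^ (p - 1) *
        ∫⁻ t, ∫⁻ ρ, (ENNReal.ofReal (t ^ (-(n * a))) * g t ρ) ^ p ∂κ ∂μ := by
        have hm : Measurable (Function.uncurry fun ρ t =>
            (ENNReal.ofReal (t ^ (-(n * a))) * g t ρ) ^ p) := by
          have : Measurable fun q : ℝ × ℝ => g q.2 q.1 := hg.comp measurable_swap
          simp only [Function.uncurry_def]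
          fun_prop
        rw [lintegral_const_mul _ (Measurable.lintegral_prod_right hm),
          lintegral_lintegral_swap hm.aemeasurable]
    _ ≤ ENNReal.ofReal (1 / (1 + a)) ^ (p - 1) * ∫⁻ t, A ∂μ := by
        refine mul_le_mul' le_rfl ?_
        refine lintegral_mono_ae ?_
        have hae : ∀ᵐ t ∂μ, t ∈ Ioo (0 : ℝ) 1 :=
          (withDensity_absolutelyContinuous _ _).ae_le (ae_restrict_mem measurableSet_Ioo)
        filter_upwards [hae] with t ht
        simp_rw [ENNReal.mul_rpow_of_nonneg _ _ hp0.le]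
        rw [lintegral_const_mul _ (by have := hgr t; fun_prop)]
        calc _ ≤ ENNReal.ofReal (t ^ (-(n * a))) ^ p * (A * ENNReal.ofReal (t ^ (n * a * p))) := by
              gcongr; exact h t ht
          _ = A := by
            rw [mul_left_comm, ENNReal.ofReal_rpow_of_pos (Real.rpow_pos_of_pos ht.1 _),
              ← Real.rpow_mul ht.1.le, ← ENNReal.ofReal_mul (Real.rpow_nonneg ht.1.le _),
              ← Real.rpow_add ht.1]
            ring_nf
            simp
    _ = _ := by
        rw [lintegral_const, hμ, mul_comm A, ← mul_assoc]
        congr 1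
        have hpos : 0 < 1 / (1 + a) := by have : 0 < 1 + a := by linarith
                                          positivity
        have h0 := (ENNReal.ofReal_pos.2 hpos).ne'
        conv_lhs => rw [← ENNReal.rpow_one (ENNReal.ofReal (1 / (1 + a)))]
        rw [← ENNReal.rpow_mul, ← ENNReal.rpow_add _ _ h0 ENNReal.ofReal_ne_top]
        congr 1
        ring

lemma sphere_univ_ennreal (n : ℕ) : sphereMeasure n univ = ENNReal.ofReal (n * nu n) := by
  rw [← sphere_univ, Measure.real, ENNReal.ofReal_toReal (measure_ne_top _ _)]

lemma measurable_smul_sphere (n : ℕ) (f : EuclideanSpace ℝ (Fin n) → ℝ) (hf : Measurable f) :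
    Measurable (fun q : ℝ × sphere (0 : EuclideanSpace ℝ (Fin n)) 1 =>
      f (q.1 • (q.2 : EuclideanSpace ℝ (Fin n)))) :=
  hf.comp (measurable_fst.smul (measurable_subtype_coe.comp measurable_snd))

lemma measurable_sphMean (n : ℕ) (f : EuclideanSpace ℝ (Fin n) → ℝ) (hf : Measurable f) :
    Measurable (sphMean n f) := by
  unfold sphMean sphInt
  refine Measurable.div_const ?_ _
  exact (StronglyMeasurable.integral_prod_right'
    (measurable_smul_sphere n f hf).stronglyMeasurable).measurable

lemma measurable_Phi (n : ℕ) (f : EuclideanSpace ℝ (Fin n) → ℝ) (hf : Measurable f) :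
    Measurable (Phi n f) := by
  unfold Phi
  have h := measurable_sphMean n f hf
  have : Measurable fun q : ℝ × ℝ => (n : ℝ) * q.2 ^ (n - 1) * sphMean n f (q.2 * q.1) := by
    fun_prop
  exact (StronglyMeasurable.integral_prod_right' this.stronglyMeasurable).measurable

/-- the angular functional -/
noncomputable def angK (n : ℕ) (pt : ℝ) (f : EuclideanSpace ℝ (Fin n) → ℝ) (c s : ℝ) : ℝ≥0∞ :=
  ∫⁻ θ : sphere (0 : EuclideanSpace ℝ (Fin n)) 1,
    ENNReal.ofReal |f (s • (θ : EuclideanSpace ℝ (Fin n))) - c| ^ pt ∂(sphereMeasure n)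

lemma measurable_angK (n : ℕ) (pt : ℝ) (f : EuclideanSpace ℝ (Fin n) → ℝ) (hf : Measurable f)
    (c : ℝ) : Measurable (angK n pt f c) := by
  unfold angK
  have := measurable_smul_sphere n f hf
  have h2 : Measurable (fun q : ℝ × sphere (0 : EuclideanSpace ℝ (Fin n)) 1 =>
      ENNReal.ofReal |f (q.1 • (q.2 : EuclideanSpace ℝ (Fin n))) - c| ^ pt) := by
    have h3 : Measurable (fun q : ℝ × sphere (0 : EuclideanSpace ℝ (Fin n)) 1 =>
      |f (q.1 • (q.2 : EuclideanSpace ℝ (Fin n))) - c|) := (this.sub_const c).abs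
    exact h3.ennreal_ofReal.pow_const pt
  exact h2.lintegral_prod_right'

lemma angular (n : ℕ) (hn : 2 ≤ n) (pt : ℝ) (hpt : 1 < pt) (f : EuclideanSpace ℝ (Fin n) → ℝ)
    (hf : Measurable f) (c s : ℝ) :
    sphereMeasure n univ * ENNReal.ofReal |sphMean n f s - c| ^ pt ≤ angK n pt f c s := by
  by_cases hK : angK n pt f c s = ⊤
  · rw [hK]; exact le_top
  have hν := nu_pos n
  have hn0 : (0 : ℝ) < n := by positivity
  have hS0 : sphereMeasure n univ ≠ 0 := by
    rw [sphere_univ_ennreal]; exact (ENNReal.ofReal_pos.2 (by positivity)).ne'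
  have hST : sphereMeasure n univ ≠ ⊤ := measure_ne_top _ _
  let h : sphere (0 : EuclideanSpace ℝ (Fin n)) 1 → ℝ :=
    fun θ => f (s • (θ : EuclideanSpace ℝ (Fin n))) - c
  have hfm : Measurable fun θ : sphere (0 : EuclideanSpace ℝ (Fin n)) 1 =>
      f (s • (θ : EuclideanSpace ℝ (Fin n))) :=
    (measurable_smul_sphere n f hf).comp (measurable_const.prodMk measurable_id)
  have hm : Measurable h := hfm.sub_const c
  have h1 := holder_fin (sphereMeasure n) pt hpt (fun θ => ENNReal.ofReal |h θ|)
    hm.abs.ennreal_ofReal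
  change _ ≤ _ * angK n pt f c s at h1
  have hlt : ∫⁻ θ, ENNReal.ofReal |h θ| ∂(sphereMeasure n) < ⊤ := by
    have h2 : sphereMeasure n univ ^ (pt - 1) * angK n pt f c s < ⊤ :=
      ENNReal.mul_lt_top (ENNReal.rpow_lt_top_of_nonneg (by linarith) hST) (Ne.lt_top hK)
    exact (ENNReal.rpow_lt_top_iff_of_pos (by linarith)).1 (h1.trans_lt h2)
  have hh_int : Integrable h (sphereMeasure n) := by
    refine ⟨hm.aestronglyMeasurable, ?_⟩
    rw [hasFiniteIntegral_iff_enorm]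
    simp_rw [Real.enorm_eq_ofReal_abs]
    exact hlt
  have hfint : Integrable (fun θ : sphere (0 : EuclideanSpace ℝ (Fin n)) 1 =>
      f (s • (θ : EuclideanSpace ℝ (Fin n)))) (sphereMeasure n) := by
    have := hh_int.add (integrable_const c)
    refine this.congr (.of_forall fun θ => ?_)
    simp [h]
  have hval : ∫ θ, h θ ∂(sphereMeasure n) = (n * nu n) * (sphMean n f s - c) := by
    simp only [h]
    rw [integral_sub hfint (integrable_const c), integral_const, sphere_univ]
    unfold sphMean sphInt
    simp only [smul_eq_mul]
    field_simp
  have h3 : sphereMeasure n univ * ENNReal.ofReal |sphMean n f s - c|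
      ≤ ∫⁻ θ, ENNReal.ofReal |h θ| ∂(sphereMeasure n) := by
    have := enorm_integral_le_lintegral_enorm (μ := sphereMeasure n) h
    simp_rw [Real.enorm_eq_ofReal_abs] at this
    refine le_trans (le_of_eq ?_) this
    rw [hval, abs_mul, abs_of_pos (by positivity : 0 < (n * nu n)),
      ENNReal.ofReal_mul (by positivity), sphere_univ_ennreal]
  have h4 : (sphereMeasure n univ * ENNReal.ofReal |sphMean n f s - c|) ^ pt ≤
      sphereMeasure n univ ^ (pt - 1) * angK n pt f c s :=
    le_trans (by gcongr) h1
  rw [ENNReal.mul_rpow_of_nonneg _ _ (by linarith),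
    show pt = (pt - 1) + 1 by ring, ENNReal.rpow_add _ _ hS0 hST, ENNReal.rpow_one,
    show (pt - 1) + 1 = pt by ring, mul_assoc] at h4
  exact (ENNReal.mul_le_mul_iff_right
    (ENNReal.rpow_pos (pos_iff_ne_zero.2 hS0) hST).ne'
    (ENNReal.rpow_lt_top_of_nonneg (by linarith) hST).ne).1 h4

lemma angular' (n : ℕ) (hn : 2 ≤ n) (p pt : ℝ) (hp : 1 < p) (hpt : 1 < pt)
    (f : EuclideanSpace ℝ (Fin n) → ℝ) (hf : Measurable f) (c s : ℝ) :
    sphereMeasure n univ ^ (p / pt) * ENNReal.ofReal |sphMean n f s - c| ^ p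
      ≤ angK n pt f c s ^ (p / pt) := by
  have h : 0 ≤ p / pt := by positivity
  calc _ = (sphereMeasure n univ * ENNReal.ofReal |sphMean n f s - c| ^ pt) ^ (p / pt) := by
        rw [ENNReal.mul_rpow_of_nonneg _ _ h, ← ENNReal.rpow_mul]
        congr 2
        field_simp
    _ ≤ _ := by
        gcongr
        exact angular n hn pt hpt f hf c s

lemma angK_radial (n : ℕ) (p pt : ℝ) (hp : 1 < p) (hpt : 1 < pt)
    (f : EuclideanSpace ℝ (Fin n) → ℝ) (c s v : ℝ)
    (h : ∀ θ : sphere (0 : EuclideanSpace ℝ (Fin n)) 1, f (s • (θ : EuclideanSpace ℝ (Fin n))) = v) :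
    angK n pt f c s ^ (p / pt) = sphereMeasure n univ ^ (p / pt) * ENNReal.ofReal |v - c| ^ p := by
  unfold angK
  simp only [h]
  rw [lintegral_const, ENNReal.mul_rpow_of_nonneg _ _ (by positivity), ← ENNReal.rpow_mul, mul_comm]
  congr 2
  field_simp

/-- the radial measure -/
noncomputable def kap (n : ℕ) (r : ℝ) : Measure ℝ :=
  (volume.restrict (Ioc (0 : ℝ) r)).withDensity (fun ρ => ENNReal.ofReal (ρ ^ ((n : ℝ) - 1)))

instance instSFiniteKap (n : ℕ) (r : ℝ) : SFinite (kap n r) := by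
  unfold kap; infer_instance

lemma lintegral_kap (n : ℕ) (r : ℝ) (G : ℝ → ℝ≥0∞) :
    ∫⁻ ρ, G ρ ∂(kap n r) = ∫⁻ ρ in Ioc (0 : ℝ) r, G ρ * ENNReal.ofReal (ρ ^ ((n : ℝ) - 1)) := by
  unfold kap
  rw [lintegral_withDensity_eq_lintegral_mul_non_measurable _ (by fun_prop)
    (.of_forall fun _ => ENNReal.ofReal_lt_top)]
  simp only [Pi.mul_apply, mul_comm]

lemma kap_ae (n : ℕ) (r : ℝ) : ∀ᵐ ρ ∂(kap n r), ρ ∈ Ioc (0 : ℝ) r :=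
  (withDensity_absolutelyContinuous _ _).ae_le (ae_restrict_mem measurableSet_Ioc)

lemma kap_scale (n : ℕ) (t r : ℝ) (ht : 0 < t) (G : ℝ → ℝ≥0∞) (hG : Measurable G) :
    ∫⁻ ρ, G (t * ρ) ∂(kap n r) = ENNReal.ofReal (t ^ (-(n : ℝ))) * ∫⁻ s, G s ∂(kap n (t * r)) := by
  rw [lintegral_kap, lintegral_kap]
  have h := lintegral_scale (fun s => G s * ENNReal.ofReal (s ^ ((n : ℝ) - 1))) (by fun_prop) t r ht
  have e : ∫⁻ ρ in Ioc (0 : ℝ) r, G (t * ρ) * ENNReal.ofReal ((t * ρ) ^ ((n : ℝ) - 1))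
      = ENNReal.ofReal (t ^ ((n : ℝ) - 1)) *
        ∫⁻ ρ in Ioc (0 : ℝ) r, G (t * ρ) * ENNReal.ofReal (ρ ^ ((n : ℝ) - 1)) := by
    rw [← lintegral_const_mul _ (by fun_prop)]
    refine setLIntegral_congr_fun measurableSet_Ioc fun ρ hρ => ?_
    rw [Real.mul_rpow ht.le hρ.1.le, ENNReal.ofReal_mul (Real.rpow_nonneg ht.le _)]
    ring
  rw [e] at h
  have h2 := congrArg (fun z => ENNReal.ofReal (t ^ (1 - (n : ℝ))) * z) h
  rw [← mul_assoc, ← mul_assoc, ← ENNReal.ofReal_mul (Real.rpow_nonneg ht.le _),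
    ← ENNReal.ofReal_mul (Real.rpow_nonneg ht.le _), ← Real.rpow_add ht, ← Real.rpow_neg_one,
    ← Real.rpow_add ht] at h2
  ring_nf at h2
  simp only [Real.rpow_zero, ENNReal.ofReal_one, one_mul] at h2
  ring_nf
  exact h2

lemma cmo_eq (n : ℕ) (p pt lam : ℝ) (f : EuclideanSpace ℝ (Fin n) → ℝ) :
    cmoMixedNorm n p pt lam f = ⨆ (r : ℝ) (_ : 0 < r),
      ((ENNReal.ofReal (nu n * r ^ ((n : ℝ) + n * lam * p)))⁻¹ *
        ∫⁻ ρ, angK n pt f (ballAvg n f r) ρ ^ (p / pt) ∂(kap n r)) ^ (1 / p) := by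
  simp_rw [lintegral_kap]
  rfl

lemma cmo_bound (n : ℕ) (p pt lam : ℝ) (hp : 1 < p) (f : EuclideanSpace ℝ (Fin n) → ℝ)
    (r : ℝ) (hr : 0 < r) :
    ∫⁻ ρ, angK n pt f (ballAvg n f r) ρ ^ (p / pt) ∂(kap n r) ≤
      ENNReal.ofReal (nu n * r ^ ((n : ℝ) + n * lam * p)) * cmoMixedNorm n p pt lam f ^ p := by
  have hν := nu_pos n
  have hX : 0 < nu n * r ^ ((n : ℝ) + n * lam * p) := by positivity
  have h : ((ENNReal.ofReal (nu n * r ^ ((n : ℝ) + n * lam * p)))⁻¹ *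
        ∫⁻ ρ, angK n pt f (ballAvg n f r) ρ ^ (p / pt) ∂(kap n r)) ^ (1 / p)
        ≤ cmoMixedNorm n p pt lam f := by
    rw [cmo_eq]
    exact le_iSup₂_of_le r hr le_rfl
  have h2 := ENNReal.rpow_le_rpow h (by linarith : 0 ≤ p)
  rw [← ENNReal.rpow_mul, one_div_mul_cancel (by linarith), ENNReal.rpow_one] at h2
  calc _ = ENNReal.ofReal (nu n * r ^ ((n : ℝ) + n * lam * p)) * _ :=
        (ENNReal.mul_inv_cancel_left (ENNReal.ofReal_pos.2 hX).ne' ENNReal.ofReal_ne_top).symm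
    _ ≤ _ := mul_le_mul' le_rfl h2

lemma cmo_le (n : ℕ) (p pt lam : ℝ) (hp : 1 < p) (f : EuclideanSpace ℝ (Fin n) → ℝ) (M : ℝ≥0∞)
    (h : ∀ r : ℝ, 0 < r → ∫⁻ ρ, angK n pt f (ballAvg n f r) ρ ^ (p / pt) ∂(kap n r) ≤
      ENNReal.ofReal (nu n * r ^ ((n : ℝ) + n * lam * p)) * M ^ p) :
    cmoMixedNorm n p pt lam f ≤ M := by
  rw [cmo_eq]
  refine iSup₂_le fun r hr => ?_
  have hν := nu_pos n
  have hX : 0 < nu n * r ^ ((n : ℝ) + n * lam * p) := by positivity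
  calc _ ≤ ((ENNReal.ofReal (nu n * r ^ ((n : ℝ) + n * lam * p)))⁻¹ *
        (ENNReal.ofReal (nu n * r ^ ((n : ℝ) + n * lam * p)) * M ^ p)) ^ (1 / p) := by
        have := h r hr
        gcongr
    _ = M := by
        rw [ENNReal.inv_mul_cancel_left (ENNReal.ofReal_pos.2 hX).ne' ENNReal.ofReal_ne_top,
          ← ENNReal.rpow_mul, mul_one_div_cancel (by linarith), ENNReal.rpow_one]

lemma kap_univ_lt_top (n : ℕ) (hn : 2 ≤ n) (r : ℝ) : kap n r univ < ⊤ := by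
  have h := lintegral_kap n r (fun _ => 1)
  simp only [lintegral_const, one_mul] at h
  rw [h]
  have hn' : (2 : ℝ) ≤ n := by exact_mod_cast hn
  calc _ ≤ ∫⁻ ρ in Ioc (0 : ℝ) r, ENNReal.ofReal (r ^ ((n : ℝ) - 1)) := by
        refine setLIntegral_mono measurable_const fun ρ hρ => ?_
        exact ENNReal.ofReal_le_ofReal (Real.rpow_le_rpow hρ.1.le hρ.2 (by linarith))
    _ < ⊤ := by
        rw [setLIntegral_const]
        exact ENNReal.mul_lt_top ENNReal.ofReal_lt_top (by simp)

lemma S_ne (n : ℕ) (hn : 2 ≤ n) : sphereMeasure n univ ≠ 0 := by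
  have hν := nu_pos n
  have hn0 : (0 : ℝ) < n := by positivity
  rw [sphere_univ_ennreal]; exact (ENNReal.ofReal_pos.2 (by positivity)).ne'

lemma Sp_ne (n : ℕ) (hn : 2 ≤ n) (q : ℝ) : sphereMeasure n univ ^ q ≠ 0 :=
  (ENNReal.rpow_pos (pos_iff_ne_zero.2 (S_ne n hn)) (measure_ne_top _ _)).ne'

lemma Sp_top (n : ℕ) (q : ℝ) (hq : 0 ≤ q) : sphereMeasure n univ ^ q ≠ ⊤ :=
  (ENNReal.rpow_lt_top_of_nonneg hq (measure_ne_top _ _)).ne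

lemma int_ball (n : ℕ) (f : EuclideanSpace ℝ (Fin n) → ℝ)
    (hloc : MeasureTheory.LocallyIntegrable f) (r : ℝ) : IntegrableOn f (ball 0 r) :=
  ((locallyIntegrable_iff.1 hloc) _ (isCompact_closedBall 0 r)).mono_set ball_subset_closedBall

/-- bound of the oscillation of the spherical means -/
lemma mean_bound (n : ℕ) (hn : 2 ≤ n) (p pt lam : ℝ)
    (hp : 1 < p) (hpt : 1 < pt) (f : EuclideanSpace ℝ (Fin n) → ℝ) (hf : Measurable f)
    (hloc : MeasureTheory.LocallyIntegrable f)
    (r : ℝ) (hr : 0 < r) :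
    sphereMeasure n univ ^ (p / pt) *
      ∫⁻ ρ, ENNReal.ofReal |sphMean n f ρ - Phi n f r| ^ p ∂(kap n r) ≤
      ENNReal.ofReal (nu n * r ^ ((n : ℝ) + n * lam * p)) * cmoMixedNorm n p pt lam f ^ p := by
  refine le_trans ?_ (cmo_bound n p pt lam hp f r hr)
  have := measurable_sphMean n f hf
  rw [← lintegral_const_mul _ (by fun_prop),
    (ballAvg_eq_Phi n hn f r hr (int_ball n f hloc r)).2]
  exact lintegral_mono fun ρ => angular' n hn p pt hp hpt f hf _ ρ

lemma mean_lp (n : ℕ) (hn : 2 ≤ n) (p pt lam : ℝ)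
    (hp : 1 < p) (hpt : 1 < pt) (f : EuclideanSpace ℝ (Fin n) → ℝ) (hf : Measurable f)
    (hloc : MeasureTheory.LocallyIntegrable f)
    (hfin : cmoMixedNorm n p pt lam f < ⊤) (r : ℝ) (hr : 0 < r) :
    ∫⁻ ρ, ENNReal.ofReal |sphMean n f ρ| ^ p ∂(kap n r) < ⊤ := by
  have hm := measurable_sphMean n f hf
  have h1 : ∫⁻ ρ, ENNReal.ofReal |sphMean n f ρ - Phi n f r| ^ p ∂(kap n r) < ⊤ := by
    have h := mean_bound n hn p pt lam hp hpt f hf hloc r hr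
    have h2 := h.trans_lt (ENNReal.mul_lt_top ENNReal.ofReal_lt_top
      (ENNReal.rpow_lt_top_of_nonneg (by linarith) hfin.ne))
    by_contra hcon
    rw [not_lt, top_le_iff] at hcon
    rw [hcon, ENNReal.mul_top (Sp_ne n hn _)] at h2
    exact lt_irrefl _ h2
  calc _ ≤ ∫⁻ ρ, (2 : ℝ≥0∞) ^ (p - 1) * (ENNReal.ofReal |sphMean n f ρ - Phi n f r| ^ p
        + ENNReal.ofReal |Phi n f r| ^ p) ∂(kap n r) := by
        refine lintegral_mono fun ρ => ?_
        refine le_trans ?_ (ENNReal.rpow_add_le_mul_rpow_add_rpow _ _ hp.le)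
        rw [← ENNReal.ofReal_add (abs_nonneg _) (abs_nonneg _)]
        gcongr
        calc _ = |(sphMean n f ρ - Phi n f r) + Phi n f r| := by ring_nf
          _ ≤ _ := abs_add_le _ _
    _ < ⊤ := by
        rw [lintegral_const_mul _ (by fun_prop), lintegral_add_right _ (by fun_prop),
          lintegral_const]
        refine ENNReal.mul_lt_top (ENNReal.rpow_lt_top_of_nonneg (by linarith) (by simp)) ?_
        refine ENNReal.add_lt_top.2 ⟨h1, ENNReal.mul_lt_top
          (ENNReal.rpow_lt_top_of_nonneg (by linarith) ENNReal.ofReal_ne_top)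
          (kap_univ_lt_top n hn r)⟩

lemma kap_mono (n : ℕ) (r r' : ℝ) (h : r ≤ r') (G : ℝ → ℝ≥0∞) :
    ∫⁻ ρ, G ρ ∂(kap n r) ≤ ∫⁻ ρ, G ρ ∂(kap n r') := by
  rw [lintegral_kap, lintegral_kap]
  exact lintegral_mono_set (Ioc_subset_Ioc_right h)

lemma ofReal_abs_integral_le (G : ℝ → ℝ) (s : Set ℝ) :
    ENNReal.ofReal |∫ t in s, G t| ≤ ∫⁻ t in s, ENNReal.ofReal |G t| := by
  have := enorm_integral_le_lintegral_enorm (μ := volume.restrict s) G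
  simp_rw [Real.enorm_eq_ofReal_abs] at this
  exact this

lemma ofReal_abs_mul_le (n : ℕ) (H : ℝ → ℝ) :
    ∫⁻ t in Ioo (0 : ℝ) 1, ENNReal.ofReal |n * t ^ (n - 1) * H t| =
    ∫⁻ t in Ioo (0 : ℝ) 1, ENNReal.ofReal (n * t ^ (n - 1)) * ENNReal.ofReal |H t| := by
  refine setLIntegral_congr_fun measurableSet_Ioo fun t ht => ?_
  have := ht.1
  have h : 0 ≤ (n : ℝ) * t ^ (n - 1) := by positivity
  rw [abs_mul, abs_of_nonneg h, ENNReal.ofReal_mul h]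

lemma Phi_lp (n : ℕ) (hn : 2 ≤ n) (p pt lam : ℝ)
    (hp : 1 < p) (hpt : 1 < pt) (f : EuclideanSpace ℝ (Fin n) → ℝ) (hf : Measurable f)
    (hloc : MeasureTheory.LocallyIntegrable f)
    (hfin : cmoMixedNorm n p pt lam f < ⊤) (r : ℝ) (hr : 0 < r) :
    ∫⁻ ρ, ENNReal.ofReal |Phi n f ρ| ^ p ∂(kap n r) < ⊤ := by
  have hm := measurable_sphMean n f hf
  have hA := mean_lp n hn p pt lam hp hpt f hf hloc hfin r hr
  have hp0 : 0 < p := by linarith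
  have h1p : 1 / p < 1 := by rw [div_lt_one hp0]; exact hp
  have hJ := hardyJ n hn p (-(1 / p)) hp (by linarith) (kap n r)
    (fun t ρ => ENNReal.ofReal |sphMean n f (t * ρ)|)
    (by simp only [Function.uncurry_def]; fun_prop)
    (∫⁻ ρ, ENNReal.ofReal |sphMean n f ρ| ^ p ∂(kap n r)) (by
      intro t ht
      rw [kap_scale n t r ht.1 (fun s => ENNReal.ofReal |sphMean n f s| ^ p) (by fun_prop), mul_comm]
      refine mul_le_mul' (kap_mono n _ _ (by nlinarith [ht.1, ht.2]) _) (le_of_eq ?_)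
      congr 2
      field_simp)
  refine lt_of_le_of_lt (le_trans ?_ hJ) (ENNReal.mul_lt_top
    (ENNReal.rpow_lt_top_of_nonneg hp0.le ENNReal.ofReal_ne_top) hA)
  refine lintegral_mono fun ρ => ?_
  gcongr
  unfold Phi
  exact (ofReal_abs_integral_le _ _).trans (ofReal_abs_mul_le n _).le

lemma hardy_on_sphere (n : ℕ) (f : EuclideanSpace ℝ (Fin n) → ℝ) (s : ℝ) (hs : 0 < s)
    (θ : sphere (0 : EuclideanSpace ℝ (Fin n)) 1) :
    sphericalHardy n f (s • (θ : EuclideanSpace ℝ (Fin n))) = ballAvg n f s := by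
  have hθ : ‖(θ : EuclideanSpace ℝ (Fin n))‖ = 1 := by simp
  have hnorm : ‖s • (θ : EuclideanSpace ℝ (Fin n))‖ = s := by
    rw [norm_smul, hθ, mul_one, Real.norm_of_nonneg hs.le]
  rw [hardy_eq, hnorm]
  rw [← norm_pos_iff, hnorm]; exact hs

lemma hardy_int (n : ℕ) (hn : 2 ≤ n) (p pt lam : ℝ)
    (hp : 1 < p) (hpt : 1 < pt) (f : EuclideanSpace ℝ (Fin n) → ℝ) (hf : Measurable f)
    (hloc : MeasureTheory.LocallyIntegrable f)
    (hfin : cmoMixedNorm n p pt lam f < ⊤) (r : ℝ) (hr : 0 < r) :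
    IntegrableOn (sphericalHardy n f) (ball 0 r) := by
  have : Nonempty (Fin n) := ⟨⟨0, by omega⟩⟩
  have hP := measurable_Phi n f hf
  have h1 : ∫⁻ ρ, ENNReal.ofReal |Phi n f ρ| ∂(kap n r) < ⊤ := by
    calc _ ≤ ∫⁻ ρ, (1 + ENNReal.ofReal |Phi n f ρ| ^ p) ∂(kap n r) := by
          refine lintegral_mono fun ρ => ?_
          rcases le_total (ENNReal.ofReal |Phi n f ρ|) 1 with h | h
          · exact h.trans le_self_add
          · refine le_trans ?_ le_add_self
            conv_lhs => rw [← ENNReal.rpow_one (ENNReal.ofReal |Phi n f ρ|)]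
            exact ENNReal.rpow_le_rpow_of_exponent_le h hp.le
      _ < ⊤ := by
          rw [lintegral_add_left measurable_const, lintegral_const, one_mul]
          exact ENNReal.add_lt_top.2 ⟨kap_univ_lt_top n hn r,
            Phi_lp n hn p pt lam hp hpt f hf hloc hfin r hr⟩
  have h2 : IntegrableOn (fun x : EuclideanSpace ℝ (Fin n) => Phi n f ‖x‖) (ball 0 r) := by
    rw [integrableOn_fun_norm_addHaar]
    refine ⟨by fun_prop, ?_⟩
    rw [hasFiniteIntegral_iff_enorm]
    refine lt_of_le_of_lt ?_ h1
    rw [lintegral_kap]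
    refine le_trans (le_of_eq ?_) (lintegral_mono_set Ioo_subset_Ioc_self)
    refine setLIntegral_congr_fun measurableSet_Ioo fun t ht => ?_
    have h1n : 1 ≤ n := by omega
    simp only [Real.enorm_eq_ofReal_abs, smul_eq_mul, finrank_euclideanSpace_fin]
    rw [abs_mul, mul_comm, ENNReal.ofReal_mul (abs_nonneg _),
      abs_of_nonneg (pow_nonneg ht.1.le _), ← Real.rpow_natCast, Nat.cast_sub h1n, Nat.cast_one]
  refine h2.congr ?_
  have h0 : ∀ᵐ x : EuclideanSpace ℝ (Fin n), x ≠ 0 := by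
    rw [ae_iff]; simp
  filter_upwards [ae_restrict_of_ae h0] with x hx
  rw [hardy_eq n f x hx, (ballAvg_eq_Phi n hn f _ (norm_pos_iff.2 hx) (int_ball n f hloc _)).2]

lemma upper (n : ℕ) (hn : 2 ≤ n) (p pt lam : ℝ)
    (hp : 1 < p) (hpt : 1 < pt) (f : EuclideanSpace ℝ (Fin n) → ℝ) (hf : Measurable f)
    (hloc : MeasureTheory.LocallyIntegrable f)
    (hlam : -(1 / p) < lam) (hfin : cmoMixedNorm n p pt lam f < ⊤) :
    cmoMixedNorm n p pt lam (sphericalHardy n f)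
        ≤ ENNReal.ofReal (1 / (1 + lam)) * cmoMixedNorm n p pt lam f := by
  have hp0 : 0 < p := by linarith
  have h1p : 1 / p < 1 := by rw [div_lt_one hp0]; exact hp
  have hm := measurable_sphMean n f hf
  have hP := measurable_Phi n f hf
  have hν := nu_pos n
  refine cmo_le n p pt lam hp _ _ fun r hr => ?_
  have hav : ∀ s : ℝ, 0 < s → ballAvg n f s = Phi n f s := fun s hs =>
    (ballAvg_eq_Phi n hn f s hs (int_ball n f hloc s)).2
  have hmean : ∀ s : ℝ, 0 < s → sphMean n (sphericalHardy n f) s = Phi n f s := by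
    intro s hs
    refine sphMean_radial n hn _ s _ fun θ => ?_
    rw [hardy_on_sphere n f s hs, hav s hs]
  obtain ⟨hci, hc⟩ := ballAvg_eq_Phi n hn (sphericalHardy n f) r hr
    (hardy_int n hn p pt lam hp hpt f hf hloc hfin r hr)
  set c := ballAvg n (sphericalHardy n f) r with hcdef
  have hmt : ∀ t ∈ Ioo (0 : ℝ) 1, n * t ^ (n - 1) * sphMean n (sphericalHardy n f) (t * r)
      = n * t ^ (n - 1) * Phi n f (t * r) := by
    intro t ht
    rw [hmean _ (mul_pos ht.1 hr)]
  have hci' := (integrableOn_congr_fun hmt measurableSet_Ioo).1 hci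
  have hc' : c = ∫ t in Ioo (0 : ℝ) 1, n * t ^ (n - 1) * Phi n f (t * r) := by
    rw [hc, Phi]
    exact setIntegral_congr_fun measurableSet_Ioo hmt
  set B := ENNReal.ofReal (nu n * r ^ ((n : ℝ) + n * lam * p)) * cmoMixedNorm n p pt lam f ^ p
    with hB
  have hq : 0 ≤ p / pt := by positivity
  have hJ := hardyJ n hn p lam hp (by linarith) (kap n r)
    (fun t ρ => ENNReal.ofReal |sphMean n f (t * ρ) - Phi n f (t * r)|)
    (by simp only [Function.uncurry_def]; fun_prop) (B / sphereMeasure n univ ^ (p / pt)) (by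
      intro t ht
      rw [kap_scale n t r ht.1 (fun s => ENNReal.ofReal |sphMean n f s - Phi n f (t * r)| ^ p)
        (by fun_prop)]
      have hb := mean_bound n hn p pt lam hp hpt f hf hloc (t * r) (mul_pos ht.1 hr)
      rw [mul_comm, ← ENNReal.le_div_iff_mul_le (Or.inl (Sp_ne n hn _)) (Or.inl (Sp_top n _ hq))] at hb
      refine (mul_le_mul' le_rfl hb).trans (le_of_eq ?_)
      rw [ENNReal.div_eq_inv_mul, ENNReal.div_eq_inv_mul, hB, Real.mul_rpow ht.1.le hr.le,
        show nu n * (t ^ ((n : ℝ) + n * lam * p) * r ^ ((n : ℝ) + n * lam * p))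
          = t ^ ((n : ℝ) + n * lam * p) * (nu n * r ^ ((n : ℝ) + n * lam * p)) by ring,
        ENNReal.ofReal_mul (Real.rpow_nonneg ht.1.le _),
        show t ^ (n * lam * p) = t ^ (-(n : ℝ)) * t ^ ((n : ℝ) + n * lam * p) by
          rw [← Real.rpow_add ht.1]; ring_nf,
        ENNReal.ofReal_mul (Real.rpow_nonneg ht.1.le _)]
      ring)
  have hpt' : ∀ ρ : ℝ, 0 < ρ → ENNReal.ofReal |Phi n f ρ - c| ≤
      ∫⁻ t in Ioo (0 : ℝ) 1, ENNReal.ofReal (n * t ^ (n - 1)) *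
        ENNReal.ofReal |sphMean n f (t * ρ) - Phi n f (t * r)| := by
    intro ρ hρ
    have hi := (ballAvg_eq_Phi n hn f ρ hρ (int_ball n f hloc ρ)).1
    have : Phi n f ρ - c = ∫ t in Ioo (0 : ℝ) 1,
        n * t ^ (n - 1) * (sphMean n f (t * ρ) - Phi n f (t * r)) := by
      rw [hc']
      conv_lhs => rw [Phi]
      rw [← integral_sub hi hci']
      simp only [mul_sub]
    rw [this]
    exact (ofReal_abs_integral_le _ _).trans (ofReal_abs_mul_le n _).le
  calc _ = ∫⁻ ρ, sphereMeasure n univ ^ (p / pt) * ENNReal.ofReal |Phi n f ρ - c| ^ p ∂(kap n r) := by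
        refine lintegral_congr_ae ?_
        filter_upwards [kap_ae n r] with ρ hρ
        refine angK_radial n p pt hp hpt _ _ _ _ fun θ => ?_
        rw [hardy_on_sphere n f ρ hρ.1, hav ρ hρ.1]
    _ = sphereMeasure n univ ^ (p / pt) * ∫⁻ ρ, ENNReal.ofReal |Phi n f ρ - c| ^ p ∂(kap n r) :=
        lintegral_const_mul _ (by fun_prop)
    _ ≤ sphereMeasure n univ ^ (p / pt) * (ENNReal.ofReal (1 / (1 + lam)) ^ p *
          (B / sphereMeasure n univ ^ (p / pt))) := by
        refine mul_le_mul' le_rfl (le_trans ?_ hJ)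
        refine lintegral_mono_ae ?_
        filter_upwards [kap_ae n r] with ρ hρ
        have := hpt' ρ hρ.1
        gcongr
    _ = ENNReal.ofReal (1 / (1 + lam)) ^ p * B := by
        rw [mul_left_comm, ENNReal.mul_div_cancel (Sp_ne n hn _) (Sp_top n _ hq)]
    _ = _ := by
        rw [hB, ENNReal.mul_rpow_of_nonneg _ _ hp0.le]
        ring

lemma psi_lemma (n : ℕ) (hn : 2 ≤ n) (p : ℝ) (hp : 1 < p) (ψ : ℝ → ℝ) (hψ : Measurable ψ)
    (D b : ℝ) (hD : 0 ≤ D) (hb : b * p < n) (hbd : ∀ t ∈ Ioc (0 : ℝ) 1, |ψ t| ≤ D * t ^ (-b))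
    (hinj : InjOn ψ (Ioi 0)) :
    ∫⁻ t, ENNReal.ofReal |ψ t| ^ p ∂(kap n 1) ≠ 0 ∧
    ∫⁻ t, ENNReal.ofReal |ψ t| ^ p ∂(kap n 1) < ⊤ := by
  have hp0 : 0 < p := by linarith
  rw [lintegral_kap]
  constructor
  · intro h0
    rw [lintegral_eq_zero_iff (by fun_prop), Filter.EventuallyEq,
      ae_restrict_iff' measurableSet_Ioc] at h0
    have hsub : ({t : ℝ | 0 < t ∧ ψ t = 0}).Subsingleton := by
      rintro x ⟨hx, hx0⟩ y ⟨hy, hy0⟩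
      exact hinj hx hy (hx0.trans hy0.symm)
    have hz : volume {t : ℝ | 0 < t ∧ ψ t = 0} = 0 := hsub.measure_zero _
    have hz' : ∀ᵐ t : ℝ, ¬ (0 < t ∧ ψ t = 0) := by
      rw [ae_iff]; simpa using hz
    have hcon : ∀ᵐ t : ℝ, t ∉ Ioc (0 : ℝ) 1 := by
      filter_upwards [h0, hz'] with t h1 h2 h3
      have h4 := h1 h3
      have ht := h3.1
      simp only [Pi.zero_apply, mul_eq_zero] at h4
      rcases h4 with h4 | h4
      · rw [ENNReal.rpow_eq_zero_iff_of_pos hp0, ENNReal.ofReal_eq_zero] at h4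
        exact h2 ⟨h3.1, abs_eq_zero.1 (le_antisymm h4 (abs_nonneg _))⟩
      · rw [ENNReal.ofReal_eq_zero] at h4
        exact absurd (Real.rpow_pos_of_pos ht ((n : ℝ) - 1)) (not_lt.2 h4)
    rw [ae_iff] at hcon
    have he : {a : ℝ | ¬ a ∉ Ioc (0 : ℝ) 1} = Ioc 0 1 := by ext; simp
    rw [he, Real.volume_Ioc] at hcon
    simp at hcon
  · calc _ ≤ ∫⁻ t in Ioc (0 : ℝ) 1, ENNReal.ofReal (D ^ p) *
          ENNReal.ofReal (t ^ ((n : ℝ) - 1 - b * p)) := by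
          refine setLIntegral_mono (by fun_prop) fun t ht => ?_
          have ht0 := ht.1
          rw [ENNReal.ofReal_rpow_of_nonneg (abs_nonneg _) hp0.le,
            ← ENNReal.ofReal_mul (by positivity), ← ENNReal.ofReal_mul (by positivity)]
          refine ENNReal.ofReal_le_ofReal ?_
          calc _ ≤ (D * t ^ (-b)) ^ p * t ^ ((n : ℝ) - 1) := by
                have := hbd t ht
                gcongr
            _ = _ := by
                rw [Real.mul_rpow hD (by positivity), ← Real.rpow_mul ht0.le, mul_assoc,
                  ← Real.rpow_add ht0]
                ring_nf
      _ < ⊤ := by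
          rw [lintegral_const_mul _ (by fun_prop), setLIntegral_congr Ioo_ae_eq_Ioc.symm,
            lintegral_pow_unit _ (by linarith)]
          exact ENNReal.mul_lt_top ENNReal.ofReal_lt_top ENNReal.ofReal_lt_top

lemma lower_aux (n : ℕ) (hn : 2 ≤ n) (p pt lam : ℝ) (hp : 1 < p) (hpt : 1 < pt)
    (φ ψ : ℝ → ℝ) (hφ : Measurable φ) (hψ : Measurable ψ) (k d : ℝ) (hk : 0 < k)
    (h1 : ∀ r : ℝ, 0 < r → IntegrableOn (fun y : ℝ => y ^ (n - 1) * φ y) (Ioo 0 r))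
    (h2 : ∀ r : ℝ, 0 < r → ∫ t in Ioo (0 : ℝ) 1, n * t ^ (n - 1) * φ (t * r) = k * φ r + d)
    (h3 : ∀ r t : ℝ, 0 < r → 0 < t → φ (r * t) - (k * φ r + d) = r ^ (n * lam) * ψ t)
    (h4 : ∫⁻ t, ENNReal.ofReal |ψ t| ^ p ∂(kap n 1) ≠ 0)
    (h5 : ∫⁻ t, ENNReal.ofReal |ψ t| ^ p ∂(kap n 1) < ⊤) (C : ℝ≥0∞)
    (hC : ∀ f : EuclideanSpace ℝ (Fin n) → ℝ, Measurable f →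
        MeasureTheory.LocallyIntegrable f → cmoMixedNorm n p pt lam f < ⊤ →
        cmoMixedNorm n p pt lam (sphericalHardy n f)
          ≤ C * cmoMixedNorm n p pt lam f) : ENNReal.ofReal k ≤ C := by
  have : Nonempty (Fin n) := ⟨⟨0, by omega⟩⟩
  have hp0 : 0 < p := by linarith
  have hν := nu_pos n
  have hq : 0 ≤ p / pt := by positivity
  let f : EuclideanSpace ℝ (Fin n) → ℝ := fun x => φ ‖x‖
  have hf : Measurable f := hφ.comp measurable_norm
  have hfb : ∀ r : ℝ, 0 < r → IntegrableOn f (ball 0 r) := by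
    intro r hr
    have := (integrableOn_fun_norm_addHaar (E := EuclideanSpace ℝ (Fin n)) volume (f := φ)
      (r := r)).2 (by simpa using h1 r hr)
    exact this
  have hloc : LocallyIntegrable f := by
    rw [locallyIntegrable_iff]
    intro K hK
    obtain ⟨r, hr⟩ := hK.isBounded.subset_ball 0
    refine (hfb (max r 1) (by positivity)).mono_set (hr.trans (ball_subset_ball (le_max_left _ _)))
  have hfθ : ∀ s : ℝ, 0 < s → ∀ θ : sphere (0 : EuclideanSpace ℝ (Fin n)) 1,
      f (s • (θ : EuclideanSpace ℝ (Fin n))) = φ s := by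
    intro s hs θ
    have hθ : ‖(θ : EuclideanSpace ℝ (Fin n))‖ = 1 := by simp
    simp only [f]
    rw [norm_smul, hθ, mul_one, Real.norm_of_nonneg hs.le]
  have hav : ∀ r : ℝ, 0 < r → ballAvg n f r = k * φ r + d := by
    intro r hr
    rw [(ballAvg_eq_Phi n hn f r hr (hfb r hr)).2, ← h2 r hr, Phi]
    refine setIntegral_congr_fun measurableSet_Ioo fun t ht => ?_
    rw [sphMean_radial n hn f _ _ (hfθ (t * r) (mul_pos ht.1 hr))]
  have havH : ∀ r : ℝ, 0 < r → ballAvg n (sphericalHardy n f) r = k * ballAvg n f r + d := by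
    intro r hr
    have h0 : ∀ᵐ x : EuclideanSpace ℝ (Fin n), x ≠ 0 := by
      rw [ae_iff]; simp
    have : ∫ x in ball 0 r, sphericalHardy n f x = ∫ x in ball 0 r, (k * f x + d) := by
      refine integral_congr_ae ?_
      filter_upwards [ae_restrict_of_ae h0] with x hx
      rw [hardy_eq n f x hx, hav _ (norm_pos_iff.2 hx)]
    unfold ballAvg
    rw [this, integral_add ((hfb r hr).const_mul k) (integrableOn_const measure_ball_lt_top.ne),
      integral_const_mul, setIntegral_const, Measure.real, vol_ball n r hr, smul_eq_mul]
    field_simp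
  have hIf : ∀ r : ℝ, 0 < r → ∫⁻ ρ, angK n pt f (ballAvg n f r) ρ ^ (p / pt) ∂(kap n r)
      = ENNReal.ofReal (r ^ ((n : ℝ) + n * lam * p)) * (sphereMeasure n univ ^ (p / pt) *
        ∫⁻ t, ENNReal.ofReal |ψ t| ^ p ∂(kap n 1)) := by
    intro r hr
    have e1 : ∫⁻ ρ, angK n pt f (ballAvg n f r) ρ ^ (p / pt) ∂(kap n r)
        = sphereMeasure n univ ^ (p / pt) *
          ∫⁻ ρ, ENNReal.ofReal |φ ρ - (k * φ r + d)| ^ p ∂(kap n r) := by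
      rw [← lintegral_const_mul _ (by fun_prop)]
      refine lintegral_congr_ae ?_
      filter_upwards [kap_ae n r] with ρ hρ
      rw [angK_radial n p pt hp hpt f _ _ _ (hfθ ρ hρ.1), hav r hr]
    have e2 := kap_scale n r 1 hr (fun s => ENNReal.ofReal |φ s - (k * φ r + d)| ^ p) (by fun_prop)
    have e3 : ∫⁻ ρ, ENNReal.ofReal |φ (r * ρ) - (k * φ r + d)| ^ p ∂(kap n 1)
        = ENNReal.ofReal (r ^ (n * lam * p)) * ∫⁻ t, ENNReal.ofReal |ψ t| ^ p ∂(kap n 1) := by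
      rw [← lintegral_const_mul _ (by fun_prop)]
      refine lintegral_congr_ae ?_
      filter_upwards [kap_ae n 1] with ρ hρ
      rw [h3 r ρ hr hρ.1, abs_mul, abs_of_pos (by positivity), ENNReal.ofReal_mul (by positivity),
        ENNReal.mul_rpow_of_nonneg _ _ hp0.le, ENNReal.ofReal_rpow_of_pos (by positivity),
        ← Real.rpow_mul hr.le]
    rw [e3, mul_one] at e2
    have e4 := congrArg (fun z => ENNReal.ofReal (r ^ (n : ℝ)) * z) e2
    rw [← mul_assoc, ← mul_assoc, ← ENNReal.ofReal_mul (by positivity),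
      ← ENNReal.ofReal_mul (by positivity), ← Real.rpow_add hr, ← Real.rpow_add hr,
      add_neg_cancel, Real.rpow_zero, ENNReal.ofReal_one, one_mul] at e4
    rw [e1, ← e4]
    ring
  set Ψ := ∫⁻ t, ENNReal.ofReal |ψ t| ^ p ∂(kap n 1) with hΨ
  set S := sphereMeasure n univ ^ (p / pt) with hS
  have hS0 : S ≠ 0 := Sp_ne n hn _
  have hST : S ≠ ⊤ := Sp_top n _ hq
  have hν0 : ENNReal.ofReal (nu n) ≠ 0 := (ENNReal.ofReal_pos.2 hν).ne'
  have hfin : cmoMixedNorm n p pt lam f < ⊤ := by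
    refine lt_of_le_of_lt (cmo_le n p pt lam hp f (((ENNReal.ofReal (nu n))⁻¹ * (S * Ψ)) ^ (1 / p))
      fun r hr => ?_) ?_
    · rw [hIf r hr, ← ENNReal.rpow_mul, one_div_mul_cancel hp0.ne', ENNReal.rpow_one,
        ENNReal.ofReal_mul hν.le, mul_comm (ENNReal.ofReal (nu n)), mul_assoc (ENNReal.ofReal _),
        ENNReal.mul_inv_cancel_left hν0 ENNReal.ofReal_ne_top]
    · refine ENNReal.rpow_lt_top_of_nonneg (by positivity) ?_
      exact ENNReal.mul_ne_top (ENNReal.inv_ne_top.2 hν0) (ENNReal.mul_ne_top hST h5.ne)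
  have hne : cmoMixedNorm n p pt lam f ≠ 0 := by
    intro h0
    have := cmo_bound n p pt lam hp f 1 one_pos
    rw [h0, hIf 1 one_pos, ENNReal.zero_rpow_of_pos hp0, mul_zero, Real.one_rpow,
      ENNReal.ofReal_one, one_mul, nonpos_iff_eq_zero, mul_eq_zero] at this
    rcases this with h | h
    · exact hS0 h
    · exact h4 h
  have hk0 : ENNReal.ofReal k ≠ 0 := (ENNReal.ofReal_pos.2 hk).ne'
  have hle : cmoMixedNorm n p pt lam f ≤
      (ENNReal.ofReal k)⁻¹ * cmoMixedNorm n p pt lam (sphericalHardy n f) := by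
    refine cmo_le n p pt lam hp f _ fun r hr => ?_
    have hb := cmo_bound n p pt lam hp (sphericalHardy n f) r hr
    have e : ∫⁻ ρ, angK n pt (sphericalHardy n f) (ballAvg n (sphericalHardy n f) r) ρ ^ (p / pt)
        ∂(kap n r) = ENNReal.ofReal k ^ p *
        ∫⁻ ρ, angK n pt f (ballAvg n f r) ρ ^ (p / pt) ∂(kap n r) := by
      have := measurable_angK n pt f hf (ballAvg n f r)
      rw [← lintegral_const_mul _ (by fun_prop)]
      refine lintegral_congr_ae ?_
      filter_upwards [kap_ae n r] with ρ hρ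
      rw [angK_radial n p pt hp hpt f _ _ _ (hfθ ρ hρ.1),
        angK_radial n p pt hp hpt (sphericalHardy n f) _ ρ _ (hardy_on_sphere n f ρ hρ.1),
        havH r hr, hav ρ hρ.1,
        show k * φ ρ + d - (k * ballAvg n f r + d) = k * (φ ρ - ballAvg n f r) by ring,
        abs_mul, abs_of_pos hk, ENNReal.ofReal_mul hk.le, ENNReal.mul_rpow_of_nonneg _ _ hp0.le]
      ring
    rw [e] at hb
    have hkp : ENNReal.ofReal k ^ p ≠ 0 :=
      (ENNReal.rpow_pos (pos_iff_ne_zero.2 hk0) ENNReal.ofReal_ne_top).ne'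
    have hkt : ENNReal.ofReal k ^ p ≠ ⊤ :=
      ENNReal.rpow_ne_top_of_nonneg hp0.le ENNReal.ofReal_ne_top
    rw [ENNReal.mul_rpow_of_nonneg _ _ hp0.le, ENNReal.inv_rpow, mul_left_comm]
    calc _ = (ENNReal.ofReal k ^ p)⁻¹ * (ENNReal.ofReal k ^ p *
        ∫⁻ ρ, angK n pt f (ballAvg n f r) ρ ^ (p / pt) ∂(kap n r)) :=
          (ENNReal.inv_mul_cancel_left hkp hkt).symm
      _ ≤ _ := mul_le_mul' le_rfl hb
  have hfinal : ENNReal.ofReal k * cmoMixedNorm n p pt lam f ≤ C * cmoMixedNorm n p pt lam f := by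
    refine le_trans ?_ (hC f hf hloc hfin)
    calc _ ≤ ENNReal.ofReal k * ((ENNReal.ofReal k)⁻¹ * cmoMixedNorm n p pt lam (sphericalHardy n f)) :=
          mul_le_mul' le_rfl hle
      _ = _ := ENNReal.mul_inv_cancel_left hk0 ENNReal.ofReal_ne_top
  exact (ENNReal.mul_le_mul_iff_left hne hfin.ne).1 hfinal

lemma pow_case (n : ℕ) (hn : 2 ≤ n) (p pt lam : ℝ) (hp : 1 < p) (hpt : 1 < pt)
    (hlam : -(1 / p) < lam) (hne : lam ≠ 0) (C : ℝ≥0∞)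
    (hC : ∀ f : EuclideanSpace ℝ (Fin n) → ℝ, Measurable f →
        MeasureTheory.LocallyIntegrable f → cmoMixedNorm n p pt lam f < ⊤ →
        cmoMixedNorm n p pt lam (sphericalHardy n f)
          ≤ C * cmoMixedNorm n p pt lam f) : ENNReal.ofReal (1 / (1 + lam)) ≤ C := by
  have hp0 : 0 < p := by linarith
  have h1p : 1 / p < 1 := by rw [div_lt_one hp0]; exact hp
  have hl : 0 < 1 + lam := by linarith
  have hn0 : (0 : ℝ) < n := by positivity
  have h1n : 1 ≤ n := by omega
  have hlp : -1 < lam * p := by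
    have := mul_lt_mul_of_pos_right hlam hp0
    rwa [neg_mul, one_div_mul_cancel hp0.ne'] at this
  have hexp : -1 < (n : ℝ) - 1 + n * lam := by nlinarith
  have hpw : ∀ y : ℝ, 0 < y → y ^ (n - 1) * y ^ (n * lam) = y ^ ((n : ℝ) - 1 + n * lam) := by
    intro y hy
    rw [Real.rpow_add hy, ← Real.rpow_natCast, Nat.cast_sub h1n, Nat.cast_one]
  obtain ⟨q1, q2⟩ := psi_lemma n hn p hp (fun t => t ^ (n * lam) - 1 / (1 + lam)) (by fun_prop)
    (1 + 1 / (1 + lam)) (max (-(n * lam)) 0) (by positivity)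
    (by
      rcases max_cases (-(n * lam)) 0 with h | h
      · rw [h.1]; nlinarith
      · rw [h.1]; linarith)
    (by
      intro t ht
      have ht0 := ht.1
      have a1 : t ^ (n * lam) ≤ t ^ (-max (-(n * lam)) 0) :=
        Real.rpow_le_rpow_of_exponent_ge ht0 ht.2 (by linarith [le_max_left (-(n * lam)) 0])
      have a2 : 1 ≤ t ^ (-max (-(n * lam)) 0) :=
        Real.one_le_rpow_of_pos_of_le_one_of_nonpos ht0 ht.2 (by linarith [le_max_right (-(n * lam)) 0])
      have a3 : 0 < t ^ (n * lam) := by positivity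
      have a4 : 0 < 1 / (1 + lam) := by positivity
      rw [abs_le]
      constructor <;> nlinarith)
    (by
      intro x hx y hy hxy
      have : x ^ (n * lam) = y ^ (n * lam) := by simpa using hxy
      exact (Real.rpow_left_inj (le_of_lt hx) (le_of_lt hy) (by positivity)).1 this)
  refine lower_aux n hn p pt lam hp hpt (fun s => s ^ (n * lam))
    (fun t => t ^ (n * lam) - 1 / (1 + lam)) (by fun_prop) (by fun_prop) (1 / (1 + lam)) 0
    (by positivity) ?_ ?_ ?_ q1 q2 C hC
  · intro r hr
    refine IntegrableOn.congr_fun (f := fun y : ℝ => y ^ ((n : ℝ) - 1 + n * lam)) ?_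
      (fun y hy => (hpw y hy.1).symm) measurableSet_Ioo
    rw [← intervalIntegrable_iff_integrableOn_Ioo_of_le hr.le]
    exact intervalIntegral.intervalIntegrable_rpow' hexp
  · intro r hr
    have : ∫ t in Ioo (0 : ℝ) 1, n * t ^ (n - 1) * (t * r) ^ (n * lam)
        = ∫ t in Ioo (0 : ℝ) 1, (n * r ^ (n * lam)) * t ^ ((n : ℝ) - 1 + n * lam) := by
      refine setIntegral_congr_fun measurableSet_Ioo fun t ht => ?_
      rw [← hpw t ht.1, Real.mul_rpow ht.1.le hr.le]
      ring
    rw [this, integral_const_mul, ← integral_Ioc_eq_integral_Ioo,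
      ← intervalIntegral.integral_of_le zero_le_one, integral_rpow (Or.inl hexp),
      Real.one_rpow, Real.zero_rpow (by linarith),
      show (n : ℝ) - 1 + n * lam + 1 = n * (1 + lam) by ring]
    field_simp
    ring
  · intro r t hr ht
    rw [Real.mul_rpow hr.le ht.le]
    ring

lemma log_case (n : ℕ) (hn : 2 ≤ n) (p pt : ℝ) (hp : 1 < p) (hpt : 1 < pt) (C : ℝ≥0∞)
    (hC : ∀ f : EuclideanSpace ℝ (Fin n) → ℝ, Measurable f →
        MeasureTheory.LocallyIntegrable f → cmoMixedNorm n p pt 0 f < ⊤ →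
        cmoMixedNorm n p pt 0 (sphericalHardy n f)
          ≤ C * cmoMixedNorm n p pt 0 f) : ENNReal.ofReal 1 ≤ C := by
  have hp0 : 0 < p := by linarith
  have hn0 : (0 : ℝ) < n := by positivity
  have hn2 : (2 : ℝ) ≤ n := by exact_mod_cast hn
  obtain ⟨q1, q2⟩ := psi_lemma n hn p hp (fun t => Real.log t + 1 / n) (by fun_prop)
    (p + 1) (1 / p) (by positivity) (by rw [one_div_mul_cancel hp0.ne']; linarith)
    (by
      intro t ht
      have ht0 := ht.1
      have a1 := Real.abs_log_mul_self_rpow_lt t (1 / p) ht0 ht.2 (by positivity)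
      rw [abs_mul, abs_of_pos (by positivity : 0 < t ^ (1 / p)), one_div_one_div] at a1
      have a2 : 1 ≤ t ^ (-(1 / p)) :=
        Real.one_le_rpow_of_pos_of_le_one_of_nonpos ht0 ht.2 (by simp; positivity)
      have a3 : |Real.log t| ≤ p * t ^ (-(1 / p)) := by
        rw [Real.rpow_neg ht0.le, ← div_eq_mul_inv, le_div_iff₀ (by positivity)]
        exact a1.le
      have a4 : |(1 : ℝ) / n| ≤ 1 := by
        rw [abs_of_pos (by positivity), div_le_one hn0]; linarith
      calc _ ≤ |Real.log t| + |(1 : ℝ) / n| := abs_add_le _ _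
        _ ≤ _ := by linarith)
    (by
      intro x hx y hy hxy
      have : Real.log x = Real.log y := by simpa using hxy
      exact Real.log_injOn_pos hx hy this)
  have hcont : Continuous fun y : ℝ => y ^ (n - 1) * Real.log y := by
    have : (fun y : ℝ => y ^ (n - 1) * Real.log y) = fun y => y ^ (n - 2) * (y * Real.log y) := by
      funext y
      rw [show n - 1 = (n - 2) + 1 by omega, pow_succ]; ring
    rw [this]
    exact (continuous_pow _).mul Real.continuous_mul_log
  refine lower_aux n hn p pt 0 hp hpt Real.log
    (fun t => Real.log t + 1 / n) (by fun_prop) (by fun_prop) 1 (-(1 / n))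
    (by positivity) ?_ ?_ ?_ q1 q2 C hC
  · intro r hr
    exact (hcont.integrableOn_Icc).mono_set Ioo_subset_Icc_self
  · intro r hr
    have : ∫ t in Ioo (0 : ℝ) 1, n * t ^ (n - 1) * Real.log (t * r)
        = ∫ t in Ioo (0 : ℝ) 1, (n * (t ^ (n - 1) * Real.log t) + n * Real.log r * t ^ (n - 1)) := by
      refine setIntegral_congr_fun measurableSet_Ioo fun t ht => ?_
      rw [Real.log_mul ht.1.ne' hr.ne']
      ring
    rw [this, ← integral_Ioc_eq_integral_Ioo, ← intervalIntegral.integral_of_le zero_le_one]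
    have hprim : ∀ t ∈ Ioo (0 : ℝ) 1, HasDerivAt
        (fun t : ℝ => t ^ n * Real.log t - t ^ n / n + Real.log r * t ^ n)
        (n * (t ^ (n - 1) * Real.log t) + n * Real.log r * t ^ (n - 1)) t := by
      intro t ht
      have b1 := hasDerivAt_pow n t
      have b2 := Real.hasDerivAt_log ht.1.ne'
      refine (((b1.mul b2).sub (b1.div_const (n : ℝ))).add (b1.const_mul (Real.log r))).congr_deriv ?_
      have : t ^ n = t ^ (n - 1) * t := by
        rw [← pow_succ]; congr 1; omega
      rw [this]
      have := ht.1.ne'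
      field_simp
      ring
    have hc1 : Continuous fun t : ℝ => t ^ n * Real.log t := by
      have : (fun y : ℝ => y ^ n * Real.log y) = fun y => y ^ (n - 1) * (y * Real.log y) := by
        funext y
        rw [← mul_assoc, ← pow_succ, show n - 1 + 1 = n by omega]
      rw [this]
      exact (continuous_pow _).mul Real.continuous_mul_log
    rw [intervalIntegral.integral_eq_sub_of_hasDerivAt_of_le zero_le_one
      (Continuous.continuousOn (by fun_prop)) hprim
      (Continuous.intervalIntegrable (by fun_prop) _ _)]
    have : n ≠ 0 := by omega
    simp [this]
    ring
  · intro r t hr ht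
    simp only [mul_zero, Real.rpow_zero]
    rw [Real.log_mul hr.ne' ht.ne']
    ring


/-- For `n ≥ 2`, `1 < p, p̃ < ∞` and `-1/p < λ < 1/n`, the spherical Hardy operator satisfies
`‖𝓗f‖ ≤ (1/(1+λ)) ‖f‖` on the mixed radial-angular `λ`-central BMO space
`CMOL^{p,λ}_{rad}L^{p̃}_{ang}(ℝⁿ)`, and `1/(1+λ)` is its exact operator norm. -/
theorem sphericalHardy_cmoMixed_norm (n : ℕ) (hn : 2 ≤ n) (p pt lam : ℝ)
    (hp : 1 < p) (hpt : 1 < pt) (hlam₁ : -(1 / p) < lam) (hlam₂ : lam < 1 / n) :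
    (∀ f : EuclideanSpace ℝ (Fin n) → ℝ, Measurable f →
      MeasureTheory.LocallyIntegrable f → cmoMixedNorm n p pt lam f < ⊤ →
      cmoMixedNorm n p pt lam (sphericalHardy n f)
        ≤ ENNReal.ofReal (1 / (1 + lam)) * cmoMixedNorm n p pt lam f) ∧
    (∀ C : ℝ≥0∞,
      (∀ f : EuclideanSpace ℝ (Fin n) → ℝ, Measurable f →
        MeasureTheory.LocallyIntegrable f → cmoMixedNorm n p pt lam f < ⊤ →
        cmoMixedNorm n p pt lam (sphericalHardy n f)
          ≤ C * cmoMixedNorm n p pt lam f) →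
      ENNReal.ofReal (1 / (1 + lam)) ≤ C) := by
  refine ⟨fun f hf hloc hfin => upper n hn p pt lam hp hpt f hf hloc hlam₁ hfin, fun C hC => ?_⟩
  by_cases h0 : lam = 0
  · subst h0
    have := log_case n hn p pt hp hpt C hC
    simpa using this
  · exact pow_case n hn p pt lam hp hpt hlam₁ h0 C hC
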